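/- If f ∈ R is atom-positive, then π_i f is atom-positive, for every index i with i + 1 < n. -/

import Mathlib

open MvPolynomial

noncomputable section

/-- Valid indices: `i` with `i + 1 < n`. -/
abbrev Idx (n : ℕ) := {i : ℕ // i + 1 < n}

/-- The element `i` of `Fin n`. -/
def idxLow {n : ℕ} (i : Idx n) : Fin n := ⟨i.1, Nat.lt_of_succ_lt i.2⟩

/-- The element `i + 1` of `Fin n`. -/
def idxHigh {n : ℕ} (i : Idx n) : Fin n := ⟨i.1 + 1, i.2⟩

/-- The simple transposition `s_i = (i, i+1)` in `S_n`. -/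
def simpleT {n : ℕ} (i : Idx n) : Equiv.Perm (Fin n) := Equiv.swap (idxLow i) (idxHigh i)

/-- The action of `s_i` on polynomials, renaming the variables `X i` and `X (i+1)`. -/
def sOp {n : ℕ} (i : Idx n) (f : MvPolynomial (Fin n) ℤ) : MvPolynomial (Fin n) ℤ :=
  rename ⇑(simpleT i) f

/-- The type of families of operators indexed by valid indices. -/
abbrev DD (n : ℕ) := Idx n → MvPolynomial (Fin n) ℤ → MvPolynomial (Fin n) ℤ

/-- `D` is the family of divided difference operators `∂_i`:
`(X i − X (i+1)) * ∂_i f = f − s_i f` (this determines `∂_i f` uniquely since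
`MvPolynomial (Fin n) ℤ` is an integral domain). -/
def IsDividedDiff {n : ℕ} (D : DD n) : Prop :=
  ∀ (i : Idx n) (f : MvPolynomial (Fin n) ℤ),
    (X (idxLow i) - X (idxHigh i)) * D i f = f - sOp i f

/-- `π_i f = ∂_i (X i * f)`. -/
def piOp {n : ℕ} (D : DD n) (i : Idx n) (f : MvPolynomial (Fin n) ℤ) :
    MvPolynomial (Fin n) ℤ :=
  D i (X (idxLow i) * f)

/-- `θ_i f = X (i+1) * ∂_i f`. -/
def thetaOp {n : ℕ} (D : DD n) (i : Idx n) (f : MvPolynomial (Fin n) ℤ) :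
    MvPolynomial (Fin n) ℤ :=
  X (idxHigh i) * D i f

/-- `θ_w = θ_{i_1} ∘ ⋯ ∘ θ_{i_k}` for a word `w = (i_1, …, i_k)`. -/
def thetaWord {n : ℕ} (D : DD n) : List (Idx n) → MvPolynomial (Fin n) ℤ → MvPolynomial (Fin n) ℤ
  | [], f => f
  | i :: w, f => thetaOp D i (thetaWord D w f)

/-- `π_w = π_{i_1} ∘ ⋯ ∘ π_{i_k}` for a word `w = (i_1, …, i_k)`. -/
def piWord {n : ℕ} (D : DD n) : List (Idx n) → MvPolynomial (Fin n) ℤ → MvPolynomial (Fin n) ℤ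
  | [], f => f
  | i :: w, f => piOp D i (piWord D w f)

/-- The permutation `s_{i_1} · ⋯ · s_{i_k}` represented by a word. -/
def wordProd {n : ℕ} (w : List (Idx n)) : Equiv.Perm (Fin n) := (w.map simpleT).prod

/-- `w` is a reduced word for `σ`: it represents `σ` and no shorter word does. -/
def IsReducedWord {n : ℕ} (w : List (Idx n)) (σ : Equiv.Perm (Fin n)) : Prop :=
  wordProd w = σ ∧ ∀ w' : List (Idx n), wordProd w' = σ → w.length ≤ w'.length

/-- The length `l(σ)`: the length of any reduced word for `σ`. -/
def len {n : ℕ} (σ : Equiv.Perm (Fin n)) : ℕ :=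
  sInf {k | ∃ w : List (Idx n), wordProd w = σ ∧ w.length = k}

/-- Strong Bruhat order: some reduced word of `γ` is a (not necessarily contiguous)
subword of some reduced word of `σ`. -/
def BruhatLE {n : ℕ} (γ σ : Equiv.Perm (Fin n)) : Prop :=
  ∃ u v : List (Idx n), IsReducedWord u γ ∧ IsReducedWord v σ ∧ u.Sublist v

/-- The monomial `x^λ = ∏ j, (X j)^(λ j)`. -/
def xpow {n : ℕ} (lam : Fin n → ℕ) : MvPolynomial (Fin n) ℤ := ∏ j, X j ^ lam j

/-- `f` is atom-positive: it lies in the additive submonoid generated by the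
Demazure atoms `θ_w (x^λ)` with `w` a reduced word and `λ` a partition. -/
def AtomPos {n : ℕ} (D : DD n) (f : MvPolynomial (Fin n) ℤ) : Prop :=
  f ∈ AddSubmonoid.closure {g : MvPolynomial (Fin n) ℤ |
    ∃ (w : List (Idx n)) (σ : Equiv.Perm (Fin n)) (lam : Fin n → ℕ),
      IsReducedWord w σ ∧ Antitone lam ∧ g = thetaWord D w (xpow lam)}

/-- `f` is key-positive: it lies in the additive submonoid generated by the
key polynomials `π_w (x^λ)` with `w` a word and `λ` a partition. -/
def KeyPos {n : ℕ} (D : DD n) (f : MvPolynomial (Fin n) ℤ) : Prop :=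
  f ∈ AddSubmonoid.closure {g : MvPolynomial (Fin n) ℤ |
    ∃ (w : List (Idx n)) (lam : Fin n → ℕ),
      Antitone lam ∧ g = piWord D w (xpow lam)}

/-- The number of inversions of a permutation. -/
def invNum {n : ℕ} (σ : Equiv.Perm (Fin n)) : ℕ :=
  (Finset.univ.filter (fun p : Fin n × Fin n => p.1 < p.2 ∧ σ p.2 < σ p.1)).card

end

section Combinatorics

variable {n : ℕ}

lemma simpleT_apply_val (i : Idx n) (a : Fin n) :
    (simpleT i a : ℕ) = if (a : ℕ) = i.1 then i.1 + 1 else if (a : ℕ) = i.1 + 1 then i.1 else a := by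
  simp only [simpleT, Equiv.swap_apply_def, idxLow, idxHigh, Fin.ext_iff]
  split_ifs <;> rfl

lemma simpleT_mul_self (i : Idx n) : simpleT i * simpleT i = 1 := Equiv.swap_mul_self _ _

lemma simpleT_simpleT (i : Idx n) (a : Fin n) : simpleT i (simpleT i a) = a :=
  Equiv.swap_apply_self _ _ _

lemma simpleT_inv (i : Idx n) : (simpleT i)⁻¹ = simpleT i := Equiv.swap_inv _ _

lemma simpleT_mul_cancel_left (i : Idx n) (σ : Equiv.Perm (Fin n)) :
    simpleT i * (simpleT i * σ) = σ := by
  rw [← mul_assoc, simpleT_mul_self, one_mul]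

lemma simpleT_low (i : Idx n) : simpleT i (idxLow i) = idxHigh i := Equiv.swap_apply_left _ _

lemma simpleT_high (i : Idx n) : simpleT i (idxHigh i) = idxLow i := Equiv.swap_apply_right _ _

lemma simpleT_of_ne {i : Idx n} {a : Fin n} (h : (a : ℕ) ≠ i.1) (h' : (a : ℕ) ≠ i.1 + 1) :
    simpleT i a = a :=
  Equiv.swap_apply_of_ne_of_ne (fun e => h (congrArg Fin.val e)) fun e => h' (congrArg Fin.val e)

lemma val_idxLow (i : Idx n) : (idxLow i : ℕ) = i.1 := rfl

lemma val_idxHigh (i : Idx n) : (idxHigh i : ℕ) = i.1 + 1 := rfl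

lemma simpleT_commute {i j : Idx n} (h : i.1 + 1 < j.1) :
    simpleT i * simpleT j = simpleT j * simpleT i := by
  refine (Equiv.Perm.disjoint_swap_swap ?_).commute.eq
  simp only [List.nodup_cons, List.mem_cons, Fin.ext_iff, val_idxLow, val_idxHigh,
    List.not_mem_nil, List.nodup_nil, not_or]
  refine ⟨⟨?_, ?_, ?_, ?_⟩, ⟨?_, ?_, ?_⟩, ⟨?_, ?_⟩, ?_, trivial⟩ <;> first | omega | exact not_false

lemma simpleT_braid {i j : Idx n} (h : i.1 + 1 = j.1) :
    simpleT i * (simpleT j * simpleT i) = simpleT j * (simpleT i * simpleT j) := by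
  have hmid : idxHigh i = idxLow j := Fin.ext h
  have hlh : idxLow i ≠ idxHigh j := by
    rw [ne_eq, Fin.ext_iff, val_idxLow, val_idxHigh]
    omega
  have hi : idxLow i ≠ idxLow j := by
    rw [ne_eq, Fin.ext_iff, val_idxLow, val_idxLow]
    omega
  have hj : idxLow j ≠ idxHigh j := by
    rw [ne_eq, Fin.ext_iff, val_idxLow, val_idxHigh]
    omega
  have h1 := Equiv.swap_mul_swap_mul_swap hi hlh
  have h2 := Equiv.swap_mul_swap_mul_swap hj.symm hlh.symm
  simp only [simpleT, hmid, ← mul_assoc]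
  rw [h1, Equiv.swap_comm (idxLow i), Equiv.swap_comm (idxLow j) (idxHigh j), h2,
    Equiv.swap_comm]

/-- An ascent at position `i` becomes a descent after composing with `s_i` on the right, and
this creates exactly one inversion. -/
lemma invNum_mul_simpleT_of_lt (τ : Equiv.Perm (Fin n)) (i : Idx n)
    (h : τ (idxLow i) < τ (idxHigh i)) : invNum (τ * simpleT i) = invNum τ + 1 := by
  have hlow := simpleT_low i
  have hhigh := simpleT_high i
  have hmono : ∀ a b : Fin n, a < b → (a, b) ≠ (idxLow i, idxHigh i) →
      simpleT i a < simpleT i b := by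
    intro a b hab hne
    have hne' : ¬ ((a : ℕ) = i.1 ∧ (b : ℕ) = i.1 + 1) := by
      rintro ⟨h1, h2⟩
      exact hne (Prod.ext (Fin.ext h1) (Fin.ext h2))
    rw [Fin.lt_def] at hab ⊢
    simp only [simpleT_apply_val]
    split_ifs <;> omega
  have hmem : (idxLow i, idxHigh i) ∈ Finset.univ.filter (fun p : Fin n × Fin n =>
      p.1 < p.2 ∧ (τ * simpleT i) p.2 < (τ * simpleT i) p.1) := by
    rw [Finset.mem_filter]
    simp only [Finset.mem_univ, true_and, Equiv.Perm.mul_apply, hlow, hhigh]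
    exact ⟨Nat.lt_succ_self _, h⟩
  rw [invNum, invNum, ← Finset.card_erase_add_one hmem]
  congr 1
  refine Finset.card_bij' (fun p _ => (simpleT i p.1, simpleT i p.2))
    (fun p _ => (simpleT i p.1, simpleT i p.2)) ?_ ?_ ?_ ?_
  · rintro ⟨a, b⟩ hp
    simp only [Finset.mem_erase, Finset.mem_filter, Finset.mem_univ, true_and] at hp ⊢
    simp only [Equiv.Perm.mul_apply] at hp ⊢
    exact ⟨hmono a b hp.2.1 hp.1, hp.2.2⟩
  · rintro ⟨a, b⟩ hp
    simp only [Finset.mem_erase, Finset.mem_filter, Finset.mem_univ, true_and] at hp ⊢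
    simp only [Equiv.Perm.mul_apply, simpleT_simpleT] at hp ⊢
    refine ⟨fun hab => ?_, hmono a b hp.1 fun hab => ?_, hp.2⟩
    · rw [Prod.mk.injEq] at hab
      have ha : a = idxHigh i := by rw [← simpleT_simpleT i a, hab.1, hlow]
      have hb : b = idxLow i := by rw [← simpleT_simpleT i b, hab.2, hhigh]
      have := hp.1
      rw [ha, hb, Fin.lt_def] at this
      simp only [idxLow, idxHigh] at this
      omega
    · rw [Prod.mk.injEq] at hab
      rw [hab.1, hab.2] at hp
      exact absurd h hp.2.le.not_gt
  · intro p _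
    simp [simpleT_simpleT]
  · intro p _
    simp [simpleT_simpleT]

lemma invNum_mul_simpleT_of_gt (τ : Equiv.Perm (Fin n)) (i : Idx n)
    (h : τ (idxHigh i) < τ (idxLow i)) : invNum (τ * simpleT i) + 1 = invNum τ := by
  rw [← invNum_mul_simpleT_of_lt]
  · rw [mul_assoc, simpleT_mul_self, mul_one]
  · simpa [simpleT] using h

lemma low_ne_high (i : Idx n) : idxLow i ≠ idxHigh i := by
  simp [idxLow, idxHigh, Fin.ext_iff]

lemma invNum_mul_simpleT_cases (τ : Equiv.Perm (Fin n)) (i : Idx n) :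
    (τ (idxLow i) < τ (idxHigh i) ∧ invNum (τ * simpleT i) = invNum τ + 1) ∨
    (τ (idxHigh i) < τ (idxLow i) ∧ invNum (τ * simpleT i) + 1 = invNum τ) := by
  rcases lt_or_gt_of_ne (fun h => low_ne_high i (τ.injective h)) with h | h
  · exact Or.inl ⟨h, invNum_mul_simpleT_of_lt τ i h⟩
  · exact Or.inr ⟨h, invNum_mul_simpleT_of_gt τ i h⟩

lemma eq_one_of_forall_lt (τ : Equiv.Perm (Fin n))
    (h : ∀ i : Idx n, τ (idxLow i) < τ (idxHigh i)) : τ = 1 := by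
  have hmono : StrictMono τ := by
    cases n with
    | zero => exact fun a => a.elim0
    | succ m =>
      refine Fin.strictMono_iff_lt_succ.2 fun k => ?_
      exact h ⟨k.1, by omega⟩
  have hiso : (RelIso.mk τ (hmono.le_iff_le) : Fin n ≃o Fin n) = OrderIso.refl _ :=
    Subsingleton.elim _ _
  ext a
  exact congrArg Fin.val (DFunLike.congr_fun hiso a)

lemma inv_simpleT_mul (i : Idx n) (σ : Equiv.Perm (Fin n)) :
    (simpleT i * σ)⁻¹ = σ⁻¹ * simpleT i := by
  rw [mul_inv_rev, simpleT_inv]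

lemma wordProd_cons (i : Idx n) (w : List (Idx n)) :
    wordProd (i :: w) = simpleT i * wordProd w := by
  simp [wordProd]

lemma invNum_one : invNum (1 : Equiv.Perm (Fin n)) = 0 := by
  unfold invNum
  rw [Finset.card_eq_zero, Finset.filter_eq_empty_iff]
  rintro p - ⟨h1, h2⟩
  exact absurd h1 h2.le.not_gt

lemma invNum_wordProd_le (w : List (Idx n)) : invNum (wordProd w)⁻¹ ≤ w.length := by
  induction w with
  | nil => simp [wordProd, invNum_one]
  | cons i w ih =>
    rw [wordProd_cons, inv_simpleT_mul, List.length_cons]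
    rcases invNum_mul_simpleT_cases (wordProd w)⁻¹ i with h | h <;> omega

lemma exists_word (σ : Equiv.Perm (Fin n)) :
    ∃ w : List (Idx n), wordProd w = σ ∧ w.length = invNum σ⁻¹ := by
  induction hk : invNum σ⁻¹ generalizing σ with
  | zero =>
    refine ⟨[], ?_, rfl⟩
    have : σ⁻¹ = 1 := eq_one_of_forall_lt _ fun i => by
      rcases invNum_mul_simpleT_cases σ⁻¹ i with h | h
      · exact h.1
      · omega
    simpa [wordProd] using (inv_eq_one.1 this).symm
  | succ k ih =>
    obtain ⟨i, hi⟩ : ∃ i : Idx n, ¬ σ⁻¹ (idxLow i) < σ⁻¹ (idxHigh i) := by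
      by_contra! hcon
      rw [eq_one_of_forall_lt _ hcon, invNum_one] at hk
      omega
    have h2 := (invNum_mul_simpleT_cases σ⁻¹ i).resolve_left fun h => hi h.1
    obtain ⟨w, hw, hl⟩ := ih (simpleT i * σ) (by rw [inv_simpleT_mul]; omega)
    exact ⟨i :: w, by rw [wordProd_cons, hw, simpleT_mul_cancel_left], by simp [hl]⟩

lemma isReducedWord_iff (w : List (Idx n)) (σ : Equiv.Perm (Fin n)) :
    IsReducedWord w σ ↔ wordProd w = σ ∧ w.length = invNum σ⁻¹ := by
  constructor
  · rintro ⟨rfl, h⟩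
    obtain ⟨w', hw', hl⟩ := exists_word (wordProd w)
    exact ⟨rfl, le_antisymm (hl ▸ h w' hw') (invNum_wordProd_le w)⟩
  · rintro ⟨rfl, h⟩
    exact ⟨rfl, fun w' hw' => h ▸ hw' ▸ invNum_wordProd_le w'⟩

/-- Matsumoto's theorem for the symmetric group: operators satisfying the braid relations
compose to the same operator along any two reduced words of the same permutation. -/
theorem foldr_eq_of_isReducedWord {α : Type*} (T : Idx n → α → α)
    (hcomm : ∀ i j : Idx n, i.1 + 1 < j.1 → ∀ f, T i (T j f) = T j (T i f))
    (hbraid : ∀ i j : Idx n, i.1 + 1 = j.1 → ∀ f, T i (T j (T i f)) = T j (T i (T j f)))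
    {σ : Equiv.Perm (Fin n)} {w w' : List (Idx n)} (hw : IsReducedWord w σ)
    (hw' : IsReducedWord w' σ) (f : α) : w.foldr T f = w'.foldr T f := by
  simp only [isReducedWord_iff] at hw hw'
  induction hk : invNum σ⁻¹ using Nat.strong_induction_on generalizing σ w w' with
  | _ k ih =>
  obtain ⟨hp, hl⟩ := hw
  obtain ⟨hp', hl'⟩ := hw'
  match w, w' with
  | [], [] => rfl
  | [], _ :: _ => simp at hl hl'; omega
  | _ :: _, [] => simp at hl hl'; omega
  | i :: v, j :: v' =>
    wlog hij : i.1 ≤ j.1 generalizing i j v v'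
    · exact (this (i := j) (v := v') hp' hl' (j := i) (v' := v) hp hl (by omega)).symm
    rw [wordProd_cons] at hp hp'
    rw [List.length_cons] at hl hl'
    have hv : wordProd v = simpleT i * σ := by rw [← hp, simpleT_mul_cancel_left]
    have hv' : wordProd v' = simpleT j * σ := by rw [← hp', simpleT_mul_cancel_left]
    have hle := invNum_wordProd_le v
    have hle' := invNum_wordProd_le v'
    rw [hv, inv_simpleT_mul] at hle
    rw [hv', inv_simpleT_mul] at hle'
    obtain ⟨hi, hi'⟩ := (invNum_mul_simpleT_cases σ⁻¹ i).resolve_left (by omega)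
    obtain ⟨hj, hj'⟩ := (invNum_mul_simpleT_cases σ⁻¹ j).resolve_left (by omega)
    have hvlen : v.length = invNum (simpleT i * σ)⁻¹ := by rw [inv_simpleT_mul]; omega
    have hvlen' : v'.length = invNum (simpleT j * σ)⁻¹ := by rw [inv_simpleT_mul]; omega
    simp only [List.foldr_cons]
    rcases Nat.lt_or_ge (i.1 + 1) j.1 with hfar | hnear
    · obtain ⟨u, hu, hul⟩ := exists_word (simpleT j * (simpleT i * σ))
      have hlow : simpleT i (idxLow j) = idxLow j :=
        simpleT_of_ne (by rw [val_idxLow]; omega) (by rw [val_idxLow]; omega)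
      have hhigh : simpleT i (idxHigh j) = idxHigh j :=
        simpleT_of_ne (by rw [val_idxHigh]; omega) (by rw [val_idxHigh]; omega)
      have hstep : invNum (simpleT j * (simpleT i * σ))⁻¹ + 1 = invNum (simpleT i * σ)⁻¹ := by
        rw [inv_simpleT_mul]
        refine invNum_mul_simpleT_of_gt _ _ ?_
        simpa only [inv_simpleT_mul, Equiv.Perm.mul_apply, hlow, hhigh] using hj
      have h1 := ih (invNum (simpleT i * σ)⁻¹) (by omega) (w := v) (w' := j :: u) ⟨hv, hvlen⟩
        ⟨by rw [wordProd_cons, hu, simpleT_mul_cancel_left], by simp only [List.length_cons]; omega⟩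
        rfl
      have h2 := ih (invNum (simpleT j * σ)⁻¹) (by omega) (w := v') (w' := i :: u) ⟨hv', hvlen'⟩
        ⟨by rw [wordProd_cons, hu, ← mul_assoc (simpleT j), ← simpleT_commute hfar, mul_assoc,
            simpleT_mul_cancel_left], by simp only [List.length_cons]; omega⟩
        rfl
      rw [h1, h2, List.foldr_cons, List.foldr_cons, hcomm i j hfar]
    rcases Nat.eq_or_lt_of_le hij with heq | hlt
    · obtain rfl : i = j := Subtype.ext heq
      rw [ih (invNum (simpleT i * σ)⁻¹) (by omega) (w := v) (w' := v') ⟨hv, hvlen⟩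
        ⟨hv', hvlen'⟩ rfl]
    · have hadj : i.1 + 1 = j.1 := by omega
      have hmid : idxHigh i = idxLow j := Fin.ext hadj
      obtain ⟨u, hu, hul⟩ := exists_word (simpleT i * (simpleT j * (simpleT i * σ)))
      have hij_low : simpleT i (idxLow j) = idxLow i := by
        rw [← hmid, simpleT_high]
      have hij_high : simpleT i (idxHigh j) = idxHigh j :=
        simpleT_of_ne (by rw [val_idxHigh]; omega) (by rw [val_idxHigh]; omega)
      have hji_low : simpleT j (idxLow i) = idxLow i :=
        simpleT_of_ne (by rw [val_idxLow]; omega) (by rw [val_idxLow]; omega)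
      have hji_high : simpleT j (idxHigh i) = idxHigh j := by
        rw [hmid, simpleT_low]
      have hstep : invNum (simpleT j * (simpleT i * σ))⁻¹ + 1 = invNum (simpleT i * σ)⁻¹ := by
        rw [inv_simpleT_mul]
        refine invNum_mul_simpleT_of_gt _ _ ?_
        simp only [inv_simpleT_mul, Equiv.Perm.mul_apply, hij_low, hij_high]
        exact hj.trans (hmid ▸ hi)
      have hstep' : invNum (simpleT i * (simpleT j * (simpleT i * σ)))⁻¹ + 1 =
          invNum (simpleT j * (simpleT i * σ))⁻¹ := by
        rw [inv_simpleT_mul]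
        refine invNum_mul_simpleT_of_gt _ _ ?_
        simp only [inv_simpleT_mul, Equiv.Perm.mul_apply, hji_low, hji_high, hij_high]
        rw [simpleT_low, hmid]
        exact hj
      have h1 := ih (invNum (simpleT i * σ)⁻¹) (by omega) (w := v) (w' := j :: i :: u)
        ⟨hv, hvlen⟩
        ⟨by rw [wordProd_cons, wordProd_cons, hu, simpleT_mul_cancel_left, simpleT_mul_cancel_left],
          by simp only [List.length_cons]; omega⟩ rfl
      have hbr : simpleT i * (simpleT j * (simpleT i * σ)) =
          simpleT j * (simpleT i * (simpleT j * σ)) := by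
        simpa only [mul_assoc] using congrArg (· * σ) (simpleT_braid hadj)
      have h2 := ih (invNum (simpleT j * σ)⁻¹) (by omega) (w := v') (w' := i :: j :: u)
        ⟨hv', hvlen'⟩
        ⟨by rw [wordProd_cons, wordProd_cons, hu, hbr, simpleT_mul_cancel_left,
            simpleT_mul_cancel_left],
          by simp only [List.length_cons]; omega⟩ rfl
      rw [h1, h2]
      simp only [List.foldr_cons]
      exact hbraid i j hadj _

end Combinatorics

section Operators

variable {n : ℕ} {D : DD n}

lemma braid_of_isobaric
    (s t : MvPolynomial (Fin n) ℤ →ₐ[ℤ] MvPolynomial (Fin n) ℤ)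
    (P Q : MvPolynomial (Fin n) ℤ → MvPolynomial (Fin n) ℤ)
    {x y z : MvPolynomial (Fin n) ℤ} (hxy : x ≠ y) (hyz : y ≠ z) (hxz : x ≠ z)
    (hsx : s x = y) (hsy : s y = x) (hsz : s z = z)
    (htx : t x = x) (hty : t y = z) (htz : t z = y)
    (hss : ∀ f, s (s f) = f) (htt : ∀ f, t (t f) = f)
    (hst : ∀ f, s (t (s f)) = t (s (t f)))
    (hP : ∀ f, (x - y) * P f = y * (f - s f)) (hQ : ∀ f, (y - z) * Q f = z * (f - t f))
    (f : MvPolynomial (Fin n) ℤ) :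
    P (Q (P f)) = Q (P (Q f)) := by
  have e3 := congrArg s (hQ (P f))
  have e5 := congrArg s (hP f)
  have e6 := congrArg t (hP f)
  have e7 := congrArg s e6
  have d3 := congrArg t (hP (Q f))
  have d5 := congrArg t (hQ f)
  have d6 := congrArg s (hQ f)
  have d7 := congrArg t d6
  simp only [map_mul, map_sub, hsx, hsy, hsz, htx, hty, htz, hss, htt] at e3 e5 e6 e7 d3 d5 d6 d7
  have hne : ((x - y) * (y - z) * (x - z)) ^ 2 ≠ 0 :=
    pow_ne_zero _ (mul_ne_zero (mul_ne_zero (sub_ne_zero.2 hxy) (sub_ne_zero.2 hyz))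
      (sub_ne_zero.2 hxz))
  refine mul_left_cancel₀ hne ?_
  linear_combination (x - y) * (y - z) ^ 2 * (x - z) ^ 2 * hP (Q (P f))
    + (x - y) * (y - z) * (x - z) ^ 2 * y * hQ (P f)
    - (x - y) * (y - z) ^ 2 * (x - z) * y * e3
    + (y - z) * (x - z) ^ 2 * y * z * hP f
    - (x - y) * (y - z) * (x - z) * y * z * e6
    + (y - z) ^ 2 * (x - z) * y * z * e5
    + (x - y) * (y - z) * (x - z) * y * z * e7
    - (x - y) ^ 2 * (y - z) * (x - z) ^ 2 * hQ (P (Q f))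
    - (x - y) * (y - z) * (x - z) ^ 2 * z * hP (Q f)
    + (x - y) ^ 2 * (y - z) * (x - z) * z * d3
    - (x - y) * (x - z) ^ 2 * y * z * hQ f
    + (x - y) * (y - z) * (x - z) * y * z * d6
    - (x - y) ^ 2 * (x - z) * z ^ 2 * d5
    - (x - y) * (y - z) * (x - z) * z ^ 2 * d7
    - (x - y) * (y - z) * (x - z) * y * z ^ 2 * hst f

lemma commute_of_isobaric
    (s t : MvPolynomial (Fin n) ℤ →ₐ[ℤ] MvPolynomial (Fin n) ℤ)
    (P Q : MvPolynomial (Fin n) ℤ → MvPolynomial (Fin n) ℤ)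
    {x y z u : MvPolynomial (Fin n) ℤ} (hxy : x ≠ y) (hzu : z ≠ u)
    (hsz : s z = z) (hsu : s u = u) (htx : t x = x) (hty : t y = y)
    (hst : ∀ f, s (t f) = t (s f))
    (hP : ∀ f, (x - y) * P f = y * (f - s f)) (hQ : ∀ f, (z - u) * Q f = u * (f - t f))
    (f : MvPolynomial (Fin n) ℤ) :
    P (Q f) = Q (P f) := by
  have e3 := congrArg s (hQ f)
  have d3 := congrArg t (hP f)
  simp only [map_mul, map_sub, hsz, hsu, htx, hty] at e3 d3
  refine mul_left_cancel₀ (mul_ne_zero (sub_ne_zero.2 hxy) (sub_ne_zero.2 hzu)) ?_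
  linear_combination (z - u) * hP (Q f) + y * hQ f - y * e3
    - (x - y) * hQ (P f) - u * hP f + u * d3 + y * u * hst f

lemma X_ne_X {a b : Fin n} (h : a ≠ b) : (X a : MvPolynomial (Fin n) ℤ) ≠ X b :=
  fun hX => h (X_injective hX)

lemma rename_perm_mul (σ τ : Equiv.Perm (Fin n)) (f : MvPolynomial (Fin n) ℤ) :
    rename σ (rename τ f) = rename ⇑(σ * τ) f := by
  rw [rename_rename, Equiv.Perm.coe_mul]

lemma rename_simpleT_self (i : Idx n) (f : MvPolynomial (Fin n) ℤ) :
    rename (simpleT i) (rename (simpleT i) f) = f := by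
  rw [rename_perm_mul, simpleT_mul_self]; exact rename_id_apply f

lemma mul_thetaOp (hD : IsDividedDiff D) (i : Idx n) (f : MvPolynomial (Fin n) ℤ) :
    (X (idxLow i) - X (idxHigh i)) * thetaOp D i f =
      X (idxHigh i) * (f - rename (simpleT i) f) := by
  have h := hD i f
  unfold sOp at h
  unfold thetaOp
  linear_combination X (idxHigh i) * h

lemma rename_simpleT_X {i : Idx n} {a b : Fin n} (h : simpleT i a = b) :
    rename (simpleT i) (X a : MvPolynomial (Fin n) ℤ) = X b := by
  rw [rename_X, h]

lemma thetaOp_commute (hD : IsDividedDiff D) {i j : Idx n} (h : i.1 + 1 < j.1)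
    (f : MvPolynomial (Fin n) ℤ) :
    thetaOp D i (thetaOp D j f) = thetaOp D j (thetaOp D i f) := by
  have hil : simpleT i (idxLow j) = idxLow j :=
    simpleT_of_ne (by rw [val_idxLow]; omega) (by rw [val_idxLow]; omega)
  have hih : simpleT i (idxHigh j) = idxHigh j :=
    simpleT_of_ne (by rw [val_idxHigh]; omega) (by rw [val_idxHigh]; omega)
  have hjl : simpleT j (idxLow i) = idxLow i :=
    simpleT_of_ne (by rw [val_idxLow]; omega) (by rw [val_idxLow]; omega)
  have hjh : simpleT j (idxHigh i) = idxHigh i :=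
    simpleT_of_ne (by rw [val_idxHigh]; omega) (by rw [val_idxHigh]; omega)
  have hst (g : MvPolynomial (Fin n) ℤ) : rename (simpleT i) (rename (simpleT j) g) =
      rename (simpleT j) (rename (simpleT i) g) := by
    rw [rename_perm_mul, rename_perm_mul, simpleT_commute h]
  exact commute_of_isobaric (rename (simpleT i)) (rename (simpleT j))
    (thetaOp D i) (thetaOp D j) (X_ne_X (low_ne_high i)) (X_ne_X (low_ne_high j))
    (rename_simpleT_X hil) (rename_simpleT_X hih) (rename_simpleT_X hjl) (rename_simpleT_X hjh)
    hst (mul_thetaOp hD i) (mul_thetaOp hD j) f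

lemma thetaOp_braid (hD : IsDividedDiff D) {i j : Idx n} (h : i.1 + 1 = j.1)
    (f : MvPolynomial (Fin n) ℤ) :
    thetaOp D i (thetaOp D j (thetaOp D i f)) = thetaOp D j (thetaOp D i (thetaOp D j f)) := by
  have hmid : idxLow j = idxHigh i := Fin.ext h.symm
  have hih : simpleT i (idxHigh j) = idxHigh j :=
    simpleT_of_ne (by rw [val_idxHigh]; omega) (by rw [val_idxHigh]; omega)
  have hjl : simpleT j (idxLow i) = idxLow i :=
    simpleT_of_ne (by rw [val_idxLow]; omega) (by rw [val_idxLow]; omega)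
  have hne : idxLow i ≠ idxHigh j := by
    rw [ne_eq, Fin.ext_iff, val_idxLow, val_idxHigh]
    omega
  have hQ := mul_thetaOp hD j
  have hjne := low_ne_high j
  have hjlow := simpleT_low j
  have hjhigh := simpleT_high j
  rw [hmid] at hQ hjne hjlow hjhigh
  have hst (g : MvPolynomial (Fin n) ℤ) :
      rename (simpleT i) (rename (simpleT j) (rename (simpleT i) g)) =
        rename (simpleT j) (rename (simpleT i) (rename (simpleT j) g)) := by
    rw [rename_perm_mul, rename_perm_mul, rename_perm_mul, rename_perm_mul, mul_assoc,
      simpleT_braid h, mul_assoc]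
  exact braid_of_isobaric (rename (simpleT i)) (rename (simpleT j))
    (thetaOp D i) (thetaOp D j) (X_ne_X (low_ne_high i)) (X_ne_X hjne) (X_ne_X hne)
    (rename_simpleT_X (simpleT_low i)) (rename_simpleT_X (simpleT_high i)) (rename_simpleT_X hih)
    (rename_simpleT_X hjl) (rename_simpleT_X hjlow) (rename_simpleT_X hjhigh)
    (rename_simpleT_self i) (rename_simpleT_self j) hst (mul_thetaOp hD i) hQ f

lemma piOp_eq_add_thetaOp (hD : IsDividedDiff D) (i : Idx n) (f : MvPolynomial (Fin n) ℤ) :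
    piOp D i f = f + thetaOp D i f := by
  refine mul_left_cancel₀ (sub_ne_zero.2 (X_ne_X (low_ne_high i))) ?_
  have h := hD i (X (idxLow i) * f)
  have hs := simpleT_low i
  simp only [sOp, map_mul, rename_X, hs] at h
  unfold piOp
  linear_combination h - mul_thetaOp hD i f

lemma piOp_thetaOp (hD : IsDividedDiff D) (i : Idx n) (f : MvPolynomial (Fin n) ℤ) :
    piOp D i (thetaOp D i f) = 0 := by
  have hne := sub_ne_zero.2 (X_ne_X (low_ne_high i))
  refine mul_left_cancel₀ (mul_ne_zero hne hne) ?_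
  have hlow := simpleT_low i
  have hhigh := simpleT_high i
  have h := congrArg (rename (simpleT i)) (mul_thetaOp hD i f)
  simp only [map_mul, map_sub, rename_X, hlow, hhigh, rename_simpleT_self] at h
  rw [piOp_eq_add_thetaOp hD]
  linear_combination (X (idxLow i) - X (idxHigh i)) * mul_thetaOp hD i (thetaOp D i f)
    + X (idxLow i) * mul_thetaOp hD i f + X (idxHigh i) * h

lemma piOp_zero (hD : IsDividedDiff D) (i : Idx n) : piOp D i 0 = 0 := by
  refine mul_left_cancel₀ (sub_ne_zero.2 (X_ne_X (low_ne_high i))) ?_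
  simpa [sOp, piOp] using hD i 0

lemma piOp_add (hD : IsDividedDiff D) (i : Idx n) (f g : MvPolynomial (Fin n) ℤ) :
    piOp D i (f + g) = piOp D i f + piOp D i g := by
  refine mul_left_cancel₀ (sub_ne_zero.2 (X_ne_X (low_ne_high i))) ?_
  simp only [piOp_eq_add_thetaOp hD]
  have h := mul_thetaOp hD i (f + g)
  rw [map_add] at h
  linear_combination h - mul_thetaOp hD i f - mul_thetaOp hD i g

lemma thetaWord_eq_foldr (w : List (Idx n)) (f : MvPolynomial (Fin n) ℤ) :
    thetaWord D w f = w.foldr (thetaOp D) f := by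
  induction w with
  | nil => rfl
  | cons i w ih => rw [thetaWord, ih, List.foldr_cons]

lemma thetaWord_eq_of_isReducedWord (hD : IsDividedDiff D) {σ : Equiv.Perm (Fin n)}
    {w w' : List (Idx n)} (hw : IsReducedWord w σ) (hw' : IsReducedWord w' σ)
    (f : MvPolynomial (Fin n) ℤ) : thetaWord D w f = thetaWord D w' f := by
  rw [thetaWord_eq_foldr, thetaWord_eq_foldr]
  exact foldr_eq_of_isReducedWord _ (fun _ _ h => thetaOp_commute hD h)
    (fun _ _ h => thetaOp_braid hD h) hw hw' f

lemma atomPos_piOp_thetaWord (hD : IsDividedDiff D) {w : List (Idx n)} {σ : Equiv.Perm (Fin n)}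
    (hw : IsReducedWord w σ) {lam : Fin n → ℕ} (hlam : Antitone lam) (i : Idx n) :
    AtomPos D (piOp D i (thetaWord D w (xpow lam))) := by
  have hw' := (isReducedWord_iff w σ).1 hw
  rcases invNum_mul_simpleT_cases σ⁻¹ i with ⟨-, h⟩ | ⟨-, h⟩
  · rw [piOp_eq_add_thetaOp hD]
    refine add_mem (AddSubmonoid.subset_closure ⟨w, σ, lam, hw, hlam, rfl⟩)
      (AddSubmonoid.subset_closure ⟨i :: w, simpleT i * σ, lam, ?_, hlam, rfl⟩)
    rw [isReducedWord_iff, wordProd_cons, hw'.1, inv_simpleT_mul, h, List.length_cons, hw'.2]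
    exact ⟨rfl, rfl⟩
  · obtain ⟨u, hu, hul⟩ := exists_word (simpleT i * σ)
    have hiu : IsReducedWord (i :: u) σ := by
      rw [isReducedWord_iff, wordProd_cons, hu, simpleT_mul_cancel_left, List.length_cons, hul,
        inv_simpleT_mul]
      exact ⟨rfl, h⟩
    rw [thetaWord_eq_of_isReducedWord hD hw hiu, thetaWord, piOp_thetaOp hD]
    exact zero_mem _

end Operators

/-- if `f` is atom-positive then so is `π_i f`. -/
theorem stmt14 (n : ℕ) (D : DD n) (hD : IsDividedDiff D)
    (f : MvPolynomial (Fin n) ℤ) (hf : AtomPos D f) (i : Idx n) :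
    AtomPos D (piOp D i f) := by
  induction hf using AddSubmonoid.closure_induction with
  | mem g hg =>
    obtain ⟨w, σ, lam, hw, hlam, rfl⟩ := hg
    exact atomPos_piOp_thetaWord hD hw hlam i
  | zero =>
    rw [piOp_zero hD]
    exact zero_mem _
  | add g h _ _ ihg ihh =>
    rw [piOp_add hD]
    exact add_mem ihg ihh
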